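/- arXiv:2008.08798 — 2 statements merged into one kernel-verified Lean document; each statement's English description precedes it below -/
import Mathlib

section
/- Let X be an EFX allocation on M' ⊆ M and g ∈ M \ M' an unallocated item. If agent i champions agent j (i.e., i ∈ A_X(X_j ∪ {g})) and i is reachable from j in the envy-graph E_X (possibly i = j), then there exists an EFX allocation Y that Pareto dominates X. -/
open Finset

/-- Additive bundle value. -/
def val {ι : Type*} (v : ι → ℝ) (S : Finset ι) : ℝ := ∑ g ∈ S, v g

/-- `i` envies `j` under allocation `X`. -/
def Envies {N ι : Type*} (v : N → ι → ℝ) (X : N → Finset ι) (i j : N) : Prop :=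
  val (v i) (X i) < val (v i) (X j)

/-- Reachability is witnessed by a chain without repeated vertices. -/
theorem exists_nodup_chain_of_reflTransGen {α : Type*} {r : α → α → Prop} {a b : α}
    (h : Relation.ReflTransGen r a b) :
    ∃ t : List α, (a :: t).Nodup ∧ (a :: t).IsChain r ∧
      (a :: t).getLast (List.cons_ne_nil a t) = b := by
  induction h using Relation.ReflTransGen.head_induction_on with
  | refl => exact ⟨[], by simp, by simp, rfl⟩
  | @head a c hac _ ih =>
    obtain ⟨t, hnodup, hchain, hlast⟩ := ih
    by_cases ha : a ∈ c :: t
    · obtain ⟨s, u, hsu⟩ := List.append_of_mem ha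
      refine ⟨u, ?_, ?_, ?_⟩
      · rw [hsu] at hnodup
        exact hnodup.of_append_right
      · rw [hsu] at hchain
        exact hchain.right_of_append
      · simp only [hsu] at hlast
        simpa using hlast
    · refine ⟨c :: t, List.nodup_cons.mpr ⟨ha, hnodup⟩, ?_, ?_⟩
      · exact List.isChain_cons_cons.mpr ⟨hac, hchain⟩
      · simpa using hlast

/-- If `b` is reachable from `a`, some permutation sends `b` back to `a` and otherwise moves
points only along the relation. -/
theorem exists_perm_of_reflTransGen {α : Type*} {r : α → α → Prop} {a b : α}
    (h : Relation.ReflTransGen r a b) :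
    ∃ σ : Equiv.Perm α, σ b = a ∧ ∀ x, x ≠ b → σ x = x ∨ r x (σ x) := by
  classical
  obtain ⟨t, hnodup, hchain, hlast⟩ := exists_nodup_chain_of_reflTransGen h
  refine ⟨(a :: t).formPerm, ?_, fun x hx => ?_⟩
  · rw [← hlast, List.formPerm_apply_getLast]
  · by_cases hmem : x ∈ a :: t
    · obtain ⟨n, hn, rfl⟩ := List.getElem_of_mem hmem
      have hn' : n + 1 < (a :: t).length := by
        by_contra hcon
        apply hx
        rw [← hlast, List.getLast_eq_getElem]
        congr 1
        omega
      right
      rw [List.formPerm_apply_lt_getElem _ hnodup n hn']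
      exact List.isChain_iff_getElem.mp hchain n hn'
    · exact Or.inl (List.formPerm_apply_of_notMem hmem)

/-- Let `X` be an EFX allocation on `M' ⊆ M` and `g ∉ M'` an unallocated item, in a
non-degenerate additive instance. If agent `i` champions agent `j` (witnessed by the
minimum preferred set `P` of `X_j ∪ {g}`) and `i` is reachable from `j` in the
envy-graph (possibly `i = j`), then there is an EFX allocation `Y` on a subset of
`M' ∪ {g}` that Pareto dominates `X`. -/
theorem champion_reachable_pareto_improvement {N ι : Type*} [Fintype N] [DecidableEq ι]
    (v : N → ι → ℝ) (hnn : ∀ i g, 0 ≤ v i g)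
    (hnd : ∀ i : N, ∀ S T : Finset ι, S ≠ T → val (v i) S ≠ val (v i) T)
    (M' : Finset ι) (X : N → Finset ι)
    (hXsub : ∀ i : N, X i ⊆ M')
    (hdisj : ∀ i j : N, i ≠ j → Disjoint (X i) (X j))
    (hEFX : ∀ i j : N, ∀ h ∈ X j, val (v i) ((X j).erase h) ≤ val (v i) (X i))
    (g : ι) (hg : g ∉ M')
    (i j : N) (P : Finset ι)
    (hPS : P ⊆ insert g (X j))
    (hP : val (v i) (X i) < val (v i) P)
    (hmin : ∀ k : N, ∀ Q ⊆ insert g (X j),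
      val (v k) (X k) < val (v k) Q → P.card ≤ Q.card)
    (hreach : Relation.ReflTransGen (Envies v X) j i) :
    ∃ Y : N → Finset ι,
      (∀ k : N, Y k ⊆ insert g M') ∧
      (∀ k l : N, k ≠ l → Disjoint (Y k) (Y l)) ∧
      (∀ k l : N, ∀ h ∈ Y l, val (v k) ((Y l).erase h) ≤ val (v k) (Y k)) ∧
      (∀ k : N, val (v k) (X k) ≤ val (v k) (Y k)) ∧
      (∃ k : N, val (v k) (X k) < val (v k) (Y k)) := by
  classical
  obtain ⟨σ, hσi, hσ⟩ := exists_perm_of_reflTransGen hreach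
  have hshift : ∀ k, k ≠ i → val (v k) (X k) ≤ val (v k) (X (σ k)) := by
    intro k hk
    rcases hσ k hk with h | h
    · rw [h]
    · exact le_of_lt h
  set Y : N → Finset ι := fun k => if k = i then P else X (σ k) with hY
  have hYi : Y i = P := if_pos rfl
  have hYne : ∀ k, k ≠ i → Y k = X (σ k) := fun k hk => if_neg hk
  have himp : ∀ k, val (v k) (X k) ≤ val (v k) (Y k) := by
    intro k
    by_cases hk : k = i
    · subst hk
      rw [hYi]
      exact hP.le
    · rw [hYne k hk]
      exact hshift k hk
  have hdisjP : ∀ k, k ≠ i → Disjoint P (X (σ k)) := by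
    intro k hk
    refine Disjoint.mono_left hPS (disjoint_insert_left.mpr ⟨fun h => hg (hXsub _ h), ?_⟩)
    apply hdisj
    rw [← hσi]
    exact fun h => hk (σ.injective h).symm
  refine ⟨Y, ?_, ?_, ?_, himp, i, hYi ▸ hP⟩
  · intro k
    by_cases hk : k = i
    · subst hk
      rw [hYi]
      exact hPS.trans (insert_subset_insert g (hXsub j))
    · rw [hYne k hk]
      exact (hXsub _).trans (subset_insert g M')
  · intro k l hkl
    by_cases hk : k = i
    · subst hk
      rw [hYi, hYne l hkl.symm]
      exact hdisjP l hkl.symm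
    · by_cases hl : l = i
      · subst hl
        rw [hYi, hYne k hk]
        exact (hdisjP k hk).symm
      · rw [hYne k hk, hYne l hl]
        exact hdisj _ _ (σ.injective.ne hkl)
  · intro k l h hh
    refine le_trans ?_ (himp k)
    by_cases hl : l = i
    · subst hl
      rw [hYi] at hh ⊢
      by_contra! hlt
      exact absurd (hmin k _ ((erase_subset h P).trans hPS) hlt)
        (not_le.mpr (card_erase_lt_of_mem hh))
    · rw [hYne l hl] at hh ⊢
      exact hEFX k (σ l) h hh
end

section
/- In any instance where each agent has one of two given additive valuation functions v_α or v_β (agents of the same type have identical valuations), a complete EFX allocation of all items always exists. -/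
open Finset

/-- No agent, holding their bundle in `X`, envies `S` after the removal of any one item. -/
def NoStrongEnvy {N ι : Type*} [DecidableEq ι] (v : N → ι → ℝ) (X : N → Finset ι)
    (S : Finset ι) : Prop :=
  ∀ i, ∀ h ∈ S, val (v i) (S.erase h) ≤ val (v i) (X i)

/-- A possibly incomplete EFX allocation. -/
structure IsPartialEFX {N ι : Type*} [DecidableEq ι] (v : N → ι → ℝ) (X : N → Finset ι) :
    Prop where
  disjoint : ∀ i j, i ≠ j → Disjoint (X i) (X j)
  efx : ∀ j, NoStrongEnvy v X (X j)

/-- Total utility, with ties broken by the number of allocated items. -/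
noncomputable def potential {N ι : Type*} [Fintype N] (v : N → ι → ℝ) (X : N → Finset ι) :
    ℝ ×ₗ ℕ :=
  toLex (∑ i, val (v i) (X i), ∑ i, (X i).card)

/-- A partial EFX allocation of maximum potential. -/
structure IsOptimal {N ι : Type*} [Fintype N] [DecidableEq ι] (v : N → ι → ℝ)
    (X : N → Finset ι) : Prop extends IsPartialEFX v X where
  le : ∀ Y, IsPartialEFX v Y → potential v Y ≤ potential v X

/-- Nobody envies the owner of the bundle `X s`. -/
def IsUnenvied {N ι : Type*} (v : N → ι → ℝ) (X : N → Finset ι) (s : N) : Prop :=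
  ∀ i, val (v i) (X s) ≤ val (v i) (X i)

section

variable {N ι : Type*}

theorem val_mono {w : ι → ℝ} (hw : ∀ g, 0 ≤ w g) {S T : Finset ι} (h : S ⊆ T) :
    val w S ≤ val w T :=
  Finset.sum_le_sum_of_subset_of_nonneg h fun g _ _ => hw g

theorem val_union [DecidableEq ι] (w : ι → ℝ) {S T : Finset ι} (h : Disjoint S T) :
    val w (S ∪ T) = val w S + val w T :=
  Finset.sum_union h

theorem val_erase_add [DecidableEq ι] (w : ι → ℝ) {S : Finset ι} {g : ι} (h : g ∈ S) :
    val w (S.erase g) + w g = val w S :=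
  Finset.sum_erase_add S w h

theorem val_sdiff_add [DecidableEq ι] (w : ι → ℝ) {S T : Finset ι} (h : S ⊆ T) :
    val w (T \ S) + val w S = val w T :=
  Finset.sum_sdiff h

/-- An envied set contains an envied subset that nobody envies strongly. -/
theorem exists_subset_noStrongEnvy [DecidableEq ι] {v : N → ι → ℝ} {X : N → Finset ι}
    {Z : Finset ι} {k : N} (hk : val (v k) (X k) < val (v k) Z) :
    ∃ S ⊆ Z, NoStrongEnvy v X S ∧ ∃ t, val (v t) (X t) < val (v t) S := by
  obtain ⟨S, hSZ, hS⟩ := exists_minimal_le_of_wellFoundedLT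
    (fun S : Finset ι => ∃ t, val (v t) (X t) < val (v t) S) Z ⟨k, hk⟩
  refine ⟨S, hSZ, fun i h hh => ?_, hS.prop⟩
  by_contra! hlt
  exact (Finset.erase_ssubset hh).not_ge (hS.le_of_le ⟨i, hlt⟩ (Finset.erase_subset h S))

/-- An unenvied agent `a` improves by trading the part `A` of their bundle for the part `B` of the
bundle of `b`, up to discarding items, if `A` and `B` are ranked oppositely by the two types. -/
theorem IsUnenvied.exists_exchange [DecidableEq ι] {v : N → ι → ℝ} {X : N → Finset ι}
    (hv : ∀ i g, 0 ≤ v i g) {a b : N} (ha : IsUnenvied v X a) (hab : ∀ i, v i = v a ∨ v i = v b)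
    {A B : Finset ι} (hA : A ⊆ X a) (hB : B ⊆ X b) (hd : Disjoint (X a) (X b))
    (hva : val (v a) A < val (v a) B) (hvb : val (v b) B ≤ val (v b) A) :
    ∃ W ⊆ B ∪ (X a \ A), NoStrongEnvy v X W ∧ val (v a) (X a) < val (v a) W := by
  have hdB : Disjoint B (X a \ A) :=
    Finset.disjoint_of_subset_left hB (Finset.disjoint_of_subset_right Finset.sdiff_subset hd.symm)
  have hval : ∀ w : ι → ℝ, val w (B ∪ (X a \ A)) + val w A = val w B + val w (X a) := fun w => by
    rw [val_union w hdB, ← val_sdiff_add w hA, add_assoc]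
  obtain ⟨W, hW, hWE, t, ht⟩ := exists_subset_noStrongEnvy (X := X) (k := a)
    (by linarith [hval (v a)] : val (v a) (X a) < val (v a) (B ∪ (X a \ A)))
  refine ⟨W, hW, hWE, ?_⟩
  have hat := ha t
  rcases hab t with h | h <;> rw [h] at hat ht
  · exact hat.trans_lt ht
  · have hle := val_mono (h ▸ hv t) hW
    linarith [hval (v b)]

/-- A self-map of a finite type permutes some nonempty set of points. -/
theorem exists_nonempty_bijOn [Finite N] [Nonempty N] (p : N → N) :
    ∃ P : Set N, P.Nonempty ∧ Set.BijOn p P P := by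
  obtain ⟨P, -, hP⟩ := exists_minimal_le_of_wellFoundedLT
    (fun P : Set N => P.Nonempty ∧ Set.MapsTo p P P) Set.univ
    ⟨Set.univ_nonempty, Set.mapsTo_univ _ _⟩
  have hsub : P ⊆ Set.image p P := hP.le_of_le
    ⟨hP.prop.1.image p, fun x hx => ⟨x, hP.prop.2.image_subset hx, rfl⟩⟩
    hP.prop.2.image_subset
  exact ⟨P, hP.prop.1, ((Set.toFinite P).surjOn_iff_bijOn_of_mapsTo hP.prop.2).1 hsub⟩

theorem exists_perm_of_bijOn {p : N → N} {P : Set N} (hp : Set.BijOn p P P) :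
    ∃ σ : Equiv.Perm N, (∀ i ∈ P, p (σ i) = i) ∧ ∀ i ∉ P, σ i = i := by
  classical
  let e : Equiv.Perm P := hp.equiv p
  refine ⟨Equiv.Perm.ofSubtype e.symm, fun i hi => ?_, fun i hi => ?_⟩
  · have h : Equiv.Perm.ofSubtype e.symm i = e.symm ⟨i, hi⟩ :=
      Equiv.Perm.ofSubtype_apply_of_mem _ hi
    rw [h]
    exact congrArg Subtype.val (e.apply_symm_apply ⟨i, hi⟩)
  · exact Equiv.Perm.ofSubtype_apply_of_not_mem _ hi

variable [Fintype N] [DecidableEq ι] {v : N → ι → ℝ} {X : N → Finset ι}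

theorem exists_isOptimal [Finite ι] (v : N → ι → ℝ) : ∃ X, IsOptimal v X := by
  have hne : {X : N → Finset ι | IsPartialEFX v X}.Nonempty :=
    ⟨fun _ => ∅, ⟨fun _ _ _ => Finset.disjoint_empty_left _, fun _ _ h hh => by simp at hh⟩⟩
  obtain ⟨X, hX, hmax⟩ := Set.exists_max_image _ (potential v) (Set.toFinite _) hne
  exact ⟨X, hX, hmax⟩

namespace IsOptimal

/-- An optimal allocation admits no Pareto improvement made of bundles without strong envy. -/
theorem val_eq_and_card_le (hX : IsOptimal v X) {Y : N → Finset ι}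
    (hd : ∀ i j, i ≠ j → Disjoint (Y i) (Y j))
    (hle : ∀ i, val (v i) (X i) ≤ val (v i) (Y i)) (hY : ∀ j, NoStrongEnvy v X (Y j)) :
    (∀ i, val (v i) (X i) = val (v i) (Y i)) ∧ ∑ i, (Y i).card ≤ ∑ i, (X i).card := by
  have h := hX.le Y ⟨hd, fun j i g hg => (hY j i g hg).trans (hle i)⟩
  have hsum : ∑ i, val (v i) (X i) ≤ ∑ i, val (v i) (Y i) :=
    Finset.sum_le_sum fun i _ => hle i
  rw [potential, potential, Prod.Lex.toLex_le_toLex] at h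
  rcases h with h | ⟨h, hc⟩
  · exact absurd h hsum.not_gt
  · exact ⟨fun i => (Finset.sum_eq_sum_iff_of_le fun i _ => hle i).1 h.symm i (mem_univ i), hc⟩

/-- Some rotation of the bundles hands an unenvied bundle to `t` and hurts nobody else. -/
theorem exists_perm_isUnenvied (hX : IsOptimal v X) (t : N) :
    ∃ σ : Equiv.Perm N, IsUnenvied v X (σ t) ∧
      ∀ i, i ≠ t → val (v i) (X i) ≤ val (v i) (X (σ i)) := by
  have hpred : ∀ i, ∃ j, (IsUnenvied v X i ∧ j = t) ∨ val (v j) (X j) < val (v j) (X i) := by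
    intro i
    by_cases hi : IsUnenvied v X i
    · exact ⟨t, Or.inl ⟨hi, rfl⟩⟩
    · simp only [IsUnenvied, not_forall, not_le] at hi
      exact hi.imp fun j => Or.inr
  choose p hp using hpred
  have : Nonempty N := ⟨t⟩
  obtain ⟨P, ⟨x, hx⟩, hbij⟩ := exists_nonempty_bijOn p
  obtain ⟨σ, hσ, hσ'⟩ := exists_perm_of_bijOn hbij
  have himp : ∀ i ∈ P, (IsUnenvied v X (σ i) ∧ i = t) ∨
      val (v i) (X i) < val (v i) (X (σ i)) := by
    intro i hi
    have h := hp (σ i)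
    rwa [hσ i hi] at h
  refine ⟨σ, ?_, fun i hit => ?_⟩
  · by_contra ht
    have hlt : ∀ i ∈ P, val (v i) (X i) < val (v i) (X (σ i)) := fun i hi =>
      (himp i hi).resolve_left fun h => ht (h.2 ▸ h.1)
    have heq := (hX.val_eq_and_card_le (Y := fun i => X (σ i))
      (fun i j hij => hX.disjoint _ _ (σ.injective.ne hij))
      (fun i => ?_) fun j => hX.efx (σ j)).1 x
    · exact (hlt x hx).ne heq
    · by_cases hi : i ∈ P
      · exact (hlt i hi).le
      · simp only [hσ' i hi, le_refl]
  · by_cases hi : i ∈ P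
    · exact ((himp i hi).resolve_left fun h => hit h.2).le
    · rw [hσ' i hi]

/-- An agent who can be handed the bundle of `s` does not envy any part of it enlarged by an
unallocated item, if nobody envies that part strongly. -/
theorem val_le_of_perm (hX : IsOptimal v X) {g : ι} (hg : ∀ i, g ∉ X i) {t : N}
    {σ : Equiv.Perm N} (hσ : ∀ i, i ≠ t → val (v i) (X i) ≤ val (v i) (X (σ i)))
    {S : Finset ι} (hS : S ⊆ insert g (X (σ t))) (hSE : NoStrongEnvy v X S) :
    val (v t) S ≤ val (v t) (X t) := by
  classical
  by_contra! hlt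
  have hdS : ∀ j, j ≠ t → Disjoint S (X (σ j)) := fun j hj =>
    Finset.disjoint_of_subset_left hS <| Finset.disjoint_insert_left.2
      ⟨hg _, hX.disjoint _ _ (σ.injective.ne hj.symm)⟩
  have heq := (hX.val_eq_and_card_le (Y := Function.update (fun i => X (σ i)) t S)
    (fun i j hij => ?_) (fun i => ?_) fun j => ?_).1 t
  · rw [Function.update_self] at heq
    exact hlt.ne heq
  · rcases eq_or_ne i t with rfl | hi
    · rw [Function.update_self, Function.update_of_ne hij.symm]
      exact hdS j hij.symm
    · rcases eq_or_ne j t with rfl | hj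
      · rw [Function.update_self, Function.update_of_ne hi]
        exact (hdS i hi).symm
      · rw [Function.update_of_ne hi, Function.update_of_ne hj]
        exact hX.disjoint _ _ (σ.injective.ne hij)
  · rcases eq_or_ne i t with rfl | hi
    · rw [Function.update_self]
      exact hlt.le
    · rw [Function.update_of_ne hi]
      exact hσ i hi
  · rcases eq_or_ne j t with rfl | hj
    · rwa [Function.update_self]
    · rw [Function.update_of_ne hj]
      exact hX.efx _

/-- Any bundle enlarged by an unallocated item is envied by somebody. -/
theorem exists_lt_val_insert (hX : IsOptimal v X) (hv : ∀ i g, 0 ≤ v i g) {g : ι}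
    (hg : ∀ i, g ∉ X i) (s : N) : ∃ k, val (v k) (X k) < val (v k) (insert g (X s)) := by
  classical
  by_contra! hno
  have hle : ∀ j, X j ⊆ Function.update X s (insert g (X s)) j := by
    intro j
    rcases eq_or_ne j s with rfl | hj
    · rw [Function.update_self]
      exact Finset.subset_insert _ _
    · rw [Function.update_of_ne hj]
  have hd : ∀ j, j ≠ s → Disjoint (insert g (X s)) (X j) := fun j hj =>
    Finset.disjoint_insert_left.2 ⟨hg j, hX.disjoint _ _ hj.symm⟩
  have hcard := (hX.val_eq_and_card_le (Y := Function.update X s (insert g (X s)))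
    (fun i j hij => ?_) (fun i => val_mono (hv i) (hle i)) fun j => ?_).2
  · refine hcard.not_gt (Finset.sum_lt_sum (fun i _ => Finset.card_le_card (hle i))
      ⟨s, mem_univ s, ?_⟩)
    rw [Function.update_self, Finset.card_insert_of_notMem (hg s)]
    exact Nat.lt_succ_self _
  · rcases eq_or_ne i s with rfl | hi
    · rw [Function.update_self, Function.update_of_ne hij.symm]
      exact hd j hij.symm
    · rcases eq_or_ne j s with rfl | hj
      · rw [Function.update_self, Function.update_of_ne hi]
        exact (hd i hi).symm
      · rw [Function.update_of_ne hi, Function.update_of_ne hj]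
        exact hX.disjoint _ _ hij
  · rcases eq_or_ne j s with rfl | hj
    · rw [Function.update_self]
      exact fun i h _ => (val_mono (hv i) (Finset.erase_subset _ _)).trans (hno i)
    · rw [Function.update_of_ne hj]
      exact hX.efx _

/-- While an item is unallocated, each type present has an unenvied agent whose bundle, enlarged
by this item, has a part envied by the other type only. -/
theorem exists_isUnenvied_of_type (hX : IsOptimal v X) (hv : ∀ i g, 0 ≤ v i g)
    {type : N → Bool} (htype : ∀ i j, type i = type j → v i = v j) {g : ι}
    (hg : ∀ i, g ∉ X i) (c : N) :
    ∃ s, type s = type c ∧ IsUnenvied v X s ∧ ∃ S ⊆ insert g (X s),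
      val (v s) S ≤ val (v s) (X s) ∧
      ∃ k, type k ≠ type c ∧ val (v k) (X k) < val (v k) S := by
  obtain ⟨t, ht, hmin⟩ := Finset.exists_min_image
    (univ.filter fun i => type i = type c) (fun i => val (v c) (X i)) ⟨c, by simp⟩
  replace ht : type t = type c := by simpa using ht
  obtain ⟨σ, hs, hσ⟩ := hX.exists_perm_isUnenvied t
  obtain ⟨k, hk⟩ := hX.exists_lt_val_insert hv hg (σ t)
  obtain ⟨S, hS, hSE, k, hk⟩ := exists_subset_noStrongEnvy hk
  have hkc : type k ≠ type c := by
    intro hkc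
    have h := hmin k (by simpa using hkc)
    rw [← htype k c hkc] at h
    have h' := hX.val_le_of_perm hg hσ hS hSE
    rw [htype t k (ht.trans hkc.symm)] at h'
    linarith
  have hself := hX.val_le_of_perm hg (t := σ t) (σ := 1) (fun _ _ => le_rfl) hS hSE
  refine ⟨σ t, ?_, hs, S, hS, hself, k, hkc, hk⟩
  by_contra hne
  have hsk : v (σ t) = v k := htype _ _ <| by
    revert hne hkc; cases type (σ t) <;> cases type k <;> cases type c <;> simp
  have h := hs k
  rw [hsk] at hself
  linarith

/-- An optimal allocation is complete. -/
theorem forall_exists_mem (hX : IsOptimal v X) (hv : ∀ i g, 0 ≤ v i g) [Nonempty N]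
    {type : N → Bool} (htype : ∀ i j, type i = type j → v i = v j) (g : ι) :
    ∃ i, g ∈ X i := by
  classical
  by_contra! hg
  obtain ⟨a, hac, ha, S, hS, hSa, k, hk, hSk⟩ :=
    hX.exists_isUnenvied_of_type hv htype hg (Classical.arbitrary N)
  obtain ⟨b, hbk, hb, T, hT, hTb, l, hl, hTl⟩ := hX.exists_isUnenvied_of_type hv htype hg k
  rw [← hac] at hk
  rw [← hbk] at hk hl
  have hla : type l = type a := by
    revert hk hl; cases type l <;> cases type a <;> cases type b <;> simp
  have htypes : ∀ i, v i = v a ∨ v i = v b := fun i => by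
    rcases eq_or_ne (type i) (type a) with h | h
    · exact Or.inl (htype _ _ h)
    · refine Or.inr (htype _ _ ?_)
      revert h hk; cases type i <;> cases type a <;> cases type b <;> simp
  have hne : a ≠ b := fun h => hk (h ▸ rfl)
  have hd := hX.disjoint a b hne
  have hSb : val (v b) (X b) < val (v b) S := by
    have h := hb k
    rw [htype k b hbk.symm] at h hSk
    exact h.trans_lt hSk
  have hTa : val (v a) (X a) < val (v a) T := by
    have h := ha l
    rw [htype l a hla] at h hTl
    exact h.trans_lt hTl
  have hgS : g ∈ S := by
    by_contra h
    have := val_mono (hv b) ((Finset.subset_insert_iff_of_notMem h).1 hS)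
    linarith [ha b]
  have hgT : g ∈ T := by
    by_contra h
    have := val_mono (hv a) ((Finset.subset_insert_iff_of_notMem h).1 hT)
    linarith [hb a]
  have hlta : val (v a) (S.erase g) < val (v a) (T.erase g) := by
    linarith [val_erase_add (v a) hgS, val_erase_add (v a) hgT]
  have hltb : val (v b) (T.erase g) < val (v b) (S.erase g) := by
    linarith [val_erase_add (v b) hgS, val_erase_add (v b) hgT]
  have hSX : S.erase g ⊆ X a := Finset.subset_insert_iff.1 hS
  have hTX : T.erase g ⊆ X b := Finset.subset_insert_iff.1 hT
  obtain ⟨A, hA, hAE, hAlt⟩ := ha.exists_exchange hv htypes hSX hTX hd hlta hltb.le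
  obtain ⟨B, hB, hBE, hBlt⟩ :=
    hb.exists_exchange hv (fun i => (htypes i).symm) hTX hSX hd.symm hltb hlta.le
  have hsub : ∀ j, j ≠ a → j ≠ b → Disjoint (X a ∪ X b) (X j) := fun j hja hjb =>
    Finset.disjoint_union_left.2 ⟨hX.disjoint _ _ hja.symm, hX.disjoint _ _ hjb.symm⟩
  have hA' : A ⊆ X a ∪ X b := by grind
  have hB' : B ⊆ X a ∪ X b := by grind
  have hAB : Disjoint A B := by
    rw [Finset.disjoint_left] at hd ⊢
    grind
  let Y : N → Finset ι := fun i => if i = a then A else if i = b then B else X i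
  have hYa : Y a = A := if_pos rfl
  have hYb : Y b = B := by simp only [Y, if_neg hne.symm, if_true]
  have hYX : ∀ j, j ≠ a → j ≠ b → Y j = X j := fun j hja hjb => by
    simp only [Y, if_neg hja, if_neg hjb]
  have heq := (hX.val_eq_and_card_le (Y := Y) (fun i j hij => ?_) (fun i => ?_) fun j => ?_).1 a
  · rw [hYa] at heq
    exact hAlt.ne heq
  · have hdA : ∀ k, k ≠ a → Disjoint A (Y k) := fun k hka => by
      rcases eq_or_ne k b with rfl | hkb
      · rwa [hYb]
      · rw [hYX k hka hkb]
        exact Finset.disjoint_of_subset_left hA' (hsub k hka hkb)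
    have hdB : ∀ k, k ≠ b → Disjoint B (Y k) := fun k hkb => by
      rcases eq_or_ne k a with rfl | hka
      · rw [hYa]
        exact hAB.symm
      · rw [hYX k hka hkb]
        exact Finset.disjoint_of_subset_left hB' (hsub k hka hkb)
    rcases eq_or_ne i a with rfl | hia
    · exact hYa.symm ▸ hdA j hij.symm
    rcases eq_or_ne i b with rfl | hib
    · exact hYb.symm ▸ hdB j hij.symm
    rcases eq_or_ne j a with rfl | hja
    · exact hYa.symm ▸ (hdA i hia).symm
    rcases eq_or_ne j b with rfl | hjb
    · exact hYb.symm ▸ (hdB i hib).symm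
    rw [hYX i hia hib, hYX j hja hjb]
    exact hX.disjoint i j hij
  · rcases eq_or_ne i a with rfl | hia
    · exact hYa.symm ▸ hAlt.le
    rcases eq_or_ne i b with rfl | hib
    · exact hYb.symm ▸ hBlt.le
    rw [hYX i hia hib]
  · rcases eq_or_ne j a with rfl | hja
    · rwa [hYa]
    rcases eq_or_ne j b with rfl | hjb
    · rwa [hYb]
    rw [hYX j hja hjb]
    exact hX.efx j

end IsOptimal

end

/-- Main theorem: if each agent has one of two additive valuations `v_α` or `v_β`
(agents of the same type have identical valuations), then a complete EFX allocation
of all items always exists. -/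
theorem complete_efx_exists_two_types {N ι : Type*} [Fintype N] [Fintype ι]
    [DecidableEq ι] [Nonempty N]
    (type : N → Bool) (va vb : ι → ℝ)
    (hnna : ∀ g, 0 ≤ va g) (hnnb : ∀ g, 0 ≤ vb g)
    (v : N → ι → ℝ) (hv : ∀ i : N, v i = if type i then va else vb) :
    ∃ X : N → Finset ι,
      (∀ i j : N, i ≠ j → Disjoint (X i) (X j)) ∧
      (∀ g : ι, ∃ i : N, g ∈ X i) ∧
      (∀ i j : N, ∀ h ∈ X j, val (v i) ((X j).erase h) ≤ val (v i) (X i)) := by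
  obtain ⟨X, hX⟩ := exists_isOptimal v
  have hnn : ∀ i g, 0 ≤ v i g := fun i g => by
    rw [hv i]
    split_ifs
    exacts [hnna g, hnnb g]
  exact ⟨X, hX.disjoint, hX.forall_exists_mem hnn (type := type)
    (fun i j h => by rw [hv i, hv j, h]), fun i j => hX.efx j i⟩
end
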